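/- Let Ω ⊂ ℝ^d be bounded open with |∂Ω| = 0, and let T = (T_t)_{t>0} be a semigroup of bounded operators on L²(Ω) such that T_t L²(Ω) ⊂ C(Ω̄) and T_t* L²(Ω) ⊂ C(Ω̄) for all t > 0. Then for each t > 0 there is a unique kernel k_t ∈ C(Ω̄ × Ω̄) such that (T_t u)(x) = ∫_Ω k_t(x,y) u(y) dy for all u ∈ L²(Ω) and x ∈ Ω. -/

import Mathlib

open MeasureTheory Filter Topology ENNReal

noncomputable section

/-- A point of `ℝ^d`. -/
abbrev Pt (d : ℕ) := EuclideanSpace ℝ (Fin d)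


lemma skc_unique {d : ℕ} {Ω : Set (Pt d)} (hΩo : IsOpen Ω) {f g : Pt d → ℂ}
    (hf : ContinuousOn f (closure Ω)) (hg : ContinuousOn g (closure Ω))
    (h : f =ᵐ[volume.restrict Ω] g) : Set.EqOn f g (closure Ω) := by
  have h1 : Set.EqOn f g Ω :=
    Measure.eqOn_open_of_ae_eq h hΩo (hf.mono subset_closure) (hg.mono subset_closure)
  exact h1.of_subset_closure hf hg subset_closure subset_rfl

lemma skc_finite {d : ℕ} {Ω : Set (Pt d)} (hΩb : Bornology.IsBounded Ω) :
    IsFiniteMeasure (volume.restrict Ω) :=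
  ⟨by rw [Measure.restrict_apply_univ]; exact hΩb.measure_lt_top⟩

lemma skc_memLp {d : ℕ} {Ω : Set (Pt d)} (hΩo : IsOpen Ω) (hΩb : Bornology.IsBounded Ω)
    {f : Pt d → ℂ} (hf : ContinuousOn f (closure Ω)) : MemLp f 2 (volume.restrict Ω) := by
  have := skc_finite hΩb
  obtain ⟨C, hC⟩ := (hΩb.isCompact_closure).exists_bound_of_continuousOn hf
  refine MemLp.of_bound ((hf.mono subset_closure).aestronglyMeasurable hΩo.measurableSet) C ?_
  filter_upwards [ae_restrict_mem hΩo.measurableSet] with x hx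
  exact hC x (subset_closure hx)

/-- zero extension of a function on the closure -/
def skcExt {d : ℕ} (Ω : Set (Pt d)) (f : C(closure Ω, ℂ)) : Pt d → ℂ :=
  Function.extend Subtype.val f 0

lemma skcExt_apply {d : ℕ} (Ω : Set (Pt d)) (f : C(closure Ω, ℂ)) (x : closure Ω) :
    skcExt Ω f x = f x := Subtype.val_injective.extend_apply _ _ _

lemma skcExt_cont {d : ℕ} (Ω : Set (Pt d)) (f : C(closure Ω, ℂ)) :
    ContinuousOn (skcExt Ω f) (closure Ω) := by
  rw [continuousOn_iff_continuous_domRestrict]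
  convert f.continuous using 1
  ext x
  exact skcExt_apply Ω f x

lemma skc_J {d : ℕ} {Ω : Set (Pt d)} (hΩo : IsOpen Ω) (hΩb : Bornology.IsBounded Ω)
    [CompactSpace (closure Ω)] :
    ∃ J : C(closure Ω, ℂ) →L[ℂ] Lp ℂ 2 (volume.restrict Ω),
      ∀ f, (J f : Pt d → ℂ) =ᵐ[volume.restrict Ω] skcExt Ω f := by
  have := skc_finite hΩb
  have hm := fun f => skc_memLp hΩo hΩb (skcExt_cont Ω f)
  let J0 : C(closure Ω, ℂ) →ₗ[ℂ] Lp ℂ 2 (volume.restrict Ω) :=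
    { toFun := fun f => (hm f).toLp
      map_add' := by
        intro f g
        rw [← MemLp.toLp_add]
        apply MemLp.toLp_congr
        filter_upwards [ae_restrict_mem hΩo.measurableSet] with x hx
        have := fun f => skcExt_apply Ω f ⟨x, subset_closure hx⟩
        simp only [Pi.add_apply] at this ⊢
        simp only [this, ContinuousMap.add_apply]
      map_smul' := by
        intro c f
        simp only [RingHom.id_apply]
        rw [← MemLp.toLp_const_smul]
        apply MemLp.toLp_congr
        filter_upwards [ae_restrict_mem hΩo.measurableSet] with x hx
        have := fun f => skcExt_apply Ω f ⟨x, subset_closure hx⟩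
        simp only [Pi.smul_apply] at this ⊢
        simp only [this, ContinuousMap.smul_apply] }
  refine ⟨J0.mkContinuous
    ((measureUnivNNReal (volume.restrict Ω) : ℝ) ^ (2 : ℝ≥0∞).toReal⁻¹) (fun f => ?_), fun f => (hm f).coeFn_toLp⟩
  · refine Lp.norm_le_of_ae_bound (norm_nonneg f) ?_
    filter_upwards [ae_restrict_mem hΩo.measurableSet, (hm f).coeFn_toLp] with x hx h
    change ‖((hm f).toLp : Pt d → ℂ) x‖ ≤ _
    rw [h, skcExt_apply Ω f ⟨x, subset_closure hx⟩]
    exact f.norm_coe_le_norm _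

lemma skc_riesz {d : ℕ} {Ω : Set (Pt d)} (hΩo : IsOpen Ω) (hΩb : Bornology.IsBounded Ω)
    (A : Lp ℂ 2 (volume.restrict Ω) →L[ℂ] Lp ℂ 2 (volume.restrict Ω))
    (hA : ∀ u : Lp ℂ 2 (volume.restrict Ω),
      ∃ g : Pt d → ℂ, ContinuousOn g (closure Ω) ∧
        (A u : Pt d → ℂ) =ᵐ[volume.restrict Ω] g) :
    ∃ (p : Pt d → Lp ℂ 2 (volume.restrict Ω)) (C : ℝ),
      (∀ x ∈ closure Ω, ‖p x‖ ≤ C) ∧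
      (∀ u, ContinuousOn (fun x => inner ℂ (p x) u) (closure Ω)) ∧
      (∀ u, (A u : Pt d → ℂ) =ᵐ[volume.restrict Ω] fun x => inner ℂ (p x) u) := by
  have : CompactSpace (closure Ω) := isCompact_iff_compactSpace.mp hΩb.isCompact_closure
  obtain ⟨J, hJ⟩ := skc_J hΩo hΩb
  have hJinj : Function.Injective J := by
    intro f g h
    have h1 : skcExt Ω f =ᵐ[volume.restrict Ω] skcExt Ω g :=
      (hJ f).symm.trans (by rw [h]; exact hJ g)
    ext x
    rw [← skcExt_apply, ← skcExt_apply]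
    exact skc_unique hΩo (skcExt_cont Ω f) (skcExt_cont Ω g) h1 x.2
  have hex : ∀ u, ∃ f, J f = A u := by
    intro u
    obtain ⟨g, hg, hgu⟩ := hA u
    refine ⟨⟨_, continuousOn_iff_continuous_domRestrict.mp hg⟩, ?_⟩
    apply Lp.ext
    refine (hJ _).trans (EventuallyEq.trans ?_ hgu.symm)
    filter_upwards [ae_restrict_mem hΩo.measurableSet] with x hx
    exact skcExt_apply Ω _ ⟨x, subset_closure hx⟩
  choose S0 hS0 using hex
  let S1 : Lp ℂ 2 (volume.restrict Ω) →ₗ[ℂ] C(closure Ω, ℂ) :=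
    { toFun := S0
      map_add' := fun u v => hJinj (by simp [hS0])
      map_smul' := fun c v => hJinj (by simp [hS0]) }
  let S : Lp ℂ 2 (volume.restrict Ω) →L[ℂ] C(closure Ω, ℂ) :=
    ContinuousLinearMap.ofSeqClosedGraph (g := S1) (by
      intro u x y hu hy
      apply hJinj
      have h1 := (J.continuous.tendsto y).comp hy
      have h2 := (A.continuous.tendsto x).comp hu
      have h3 : J ∘ S1 ∘ u = A ∘ u := by
        ext1 n; exact hS0 _
      rw [h3] at h1
      exact (tendsto_nhds_unique h1 h2).trans (hS0 x).symm)
  have hS : ∀ u, J (S u) = A u := hS0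
  let ev : closure Ω → (Lp ℂ 2 (volume.restrict Ω) →L[ℂ] ℂ) := fun x =>
    (ContinuousMap.evalCLM ℂ x).comp S
  classical
  let p : Pt d → Lp ℂ 2 (volume.restrict Ω) := fun x =>
    if hx : x ∈ closure Ω then (InnerProductSpace.toDual ℂ _).symm (ev ⟨x, hx⟩) else 0
  have hp : ∀ x (hx : x ∈ closure Ω) u, inner ℂ (p x) u = S u ⟨x, hx⟩ := by
    intro x hx u
    simp only [p, dif_pos hx, InnerProductSpace.toDual_symm_apply]
    rfl
  have hp2 : ∀ u, Set.EqOn (fun x => inner ℂ (p x) u) (skcExt Ω (S u)) (closure Ω) := by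
    intro u x hx
    exact (hp x hx u).trans (skcExt_apply Ω (S u) ⟨x, hx⟩).symm
  refine ⟨p, ‖S‖, ?_, ?_, ?_⟩
  · intro x hx
    simp only [p, dif_pos hx, LinearIsometryEquiv.norm_map]
    refine ContinuousLinearMap.opNorm_le_bound _ (norm_nonneg _) (fun u => ?_)
    exact ((S u).norm_coe_le_norm _).trans (S.le_opNorm u)
  · intro u
    exact (skcExt_cont Ω (S u)).congr (hp2 u)
  · intro u
    rw [← hS u]
    refine (hJ _).trans ?_
    filter_upwards [ae_restrict_mem hΩo.measurableSet] with x hx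
    exact (hp2 u (subset_closure hx)).symm

lemma skc_normcont {d : ℕ} {Ω : Set (Pt d)} (hΩo : IsOpen Ω) (hΩb : Bornology.IsBounded Ω)
    (A : Lp ℂ 2 (volume.restrict Ω) →L[ℂ] Lp ℂ 2 (volume.restrict Ω))
    (p q : Pt d → Lp ℂ 2 (volume.restrict Ω)) (C D : ℝ)
    (hpC : ∀ x ∈ closure Ω, ‖p x‖ ≤ C) (hqD : ∀ x ∈ closure Ω, ‖q x‖ ≤ D)
    (hp : ∀ u, ContinuousOn (fun x => inner ℂ (p x) u) (closure Ω))
    (hq : ∀ u, ContinuousOn (fun x => inner ℂ (q x) u) (closure Ω))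
    (hA : ∀ u, (A u : Pt d → ℂ) =ᵐ[volume.restrict Ω] fun x => inner ℂ (p x) u) :
    ContinuousOn (fun y => A (q y)) (closure Ω) := by
  have := skc_finite hΩb
  intro y₀ hy₀
  change Tendsto _ _ _
  rw [tendsto_iff_norm_sub_tendsto_zero]
  have key : ∀ v, ‖A v‖ ^ 2 = ∫ x in Ω, ‖(inner ℂ (p x) v : ℂ)‖ ^ 2 := by
    intro v
    have h1 : ((‖A v‖ ^ 2 : ℝ) : ℂ) = inner ℂ (A v) (A v) := by
      rw [inner_self_eq_norm_sq_to_K]; norm_cast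
    rw [L2.inner_def] at h1
    have h2 : (∫ x in Ω, inner ℂ (A v x) (A v x) : ℂ)
        = ∫ x in Ω, ((‖(inner ℂ (p x) v : ℂ)‖ ^ 2 : ℝ) : ℂ) := by
      apply integral_congr_ae
      filter_upwards [hA v] with x hx
      rw [hx, inner_self_eq_norm_sq_to_K]; norm_cast
    rw [h2, integral_complex_ofReal] at h1
    exact Complex.ofReal_injective h1
  have h0 : Tendsto (fun y => ‖A (q y) - A (q y₀)‖ ^ 2) (𝓝[closure Ω] y₀) (𝓝 0) := by
    simp_rw [← map_sub, key]
    rw [show (0:ℝ) = ∫ x in Ω, (0:ℝ) by simp]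
    refine tendsto_integral_filter_of_dominated_convergence (fun _ => (C * (D + D)) ^ 2)
      ?_ ?_ (integrable_const _) ?_
    · refine Eventually.of_forall fun y => ?_
      exact (((hp (q y - q y₀)).mono subset_closure).norm.pow 2).aestronglyMeasurable
        hΩo.measurableSet
    · filter_upwards [self_mem_nhdsWithin] with y hy
      filter_upwards [ae_restrict_mem hΩo.measurableSet] with x hx
      rw [Real.norm_of_nonneg (by positivity)]
      have hC := hpC x (subset_closure hx)
      have hC0 : 0 ≤ C := (norm_nonneg _).trans hC
      gcongr
      refine (norm_inner_le_norm _ _).trans ?_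
      gcongr
      exact (norm_sub_le _ _).trans (add_le_add (hqD y hy) (hqD y₀ hy₀))
    · filter_upwards [ae_restrict_mem hΩo.measurableSet] with x hx
      have h1 : Tendsto (fun y => inner ℂ (q y) (p x)) (𝓝[closure Ω] y₀)
        (𝓝 (inner ℂ (q y₀) (p x))) := hq (p x) y₀ hy₀
      have h2 := ((tendsto_iff_norm_sub_tendsto_zero.mp h1).pow 2)
      rw [zero_pow two_ne_zero] at h2
      refine h2.congr fun y => ?_
      rw [← inner_sub_left, norm_inner_symm]
  have h3 := h0.sqrt
  simpa using h3

/-- Proposition 4.3: let `Ω ⊆ ℝ^d` be bounded open with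
`|∂Ω| = 0` and `T = (T_t)_{t>0}` a semigroup of bounded operators on `L²(Ω)` such
that `T_t L²(Ω) ⊆ C(Ω̄)` and `T_t^* L²(Ω) ⊆ C(Ω̄)` for all `t > 0`.  Then for each
`t > 0` there is a unique kernel `k_t ∈ C(Ω̄ × Ω̄)` with
`(T_t u)(x) = ∫_Ω k_t(x,y) u(y) dy` for all `u ∈ L²(Ω)` and `x ∈ Ω` (where `T_t u`
is evaluated via its continuous representative). -/
theorem semigroup_continuous_kernel
    (d : ℕ) (Ω : Set (Pt d)) (hΩo : IsOpen Ω) (hΩb : Bornology.IsBounded Ω)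
    (hbdry : volume (frontier Ω) = 0)
    (T : ℝ → (Lp ℂ 2 (volume.restrict Ω) →L[ℂ] Lp ℂ 2 (volume.restrict Ω)))
    (hsemi : ∀ t s : ℝ, 0 < t → 0 < s → T (t + s) = (T t).comp (T s))
    (hcont : ∀ t : ℝ, 0 < t → ∀ u : Lp ℂ 2 (volume.restrict Ω),
      ∃ g : Pt d → ℂ, ContinuousOn g (closure Ω) ∧
        (T t u : Pt d → ℂ) =ᵐ[volume.restrict Ω] g)
    (hcont_adj : ∀ t : ℝ, 0 < t → ∀ u : Lp ℂ 2 (volume.restrict Ω),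
      ∃ g : Pt d → ℂ, ContinuousOn g (closure Ω) ∧
        ((ContinuousLinearMap.adjoint (T t)) u : Pt d → ℂ) =ᵐ[volume.restrict Ω] g) :
    ∀ t : ℝ, 0 < t →
      (∃ k : Pt d → Pt d → ℂ,
        ContinuousOn (Function.uncurry k) (closure Ω ×ˢ closure Ω) ∧
        ∀ u : Lp ℂ 2 (volume.restrict Ω), ∀ g : Pt d → ℂ,
          ContinuousOn g (closure Ω) → (T t u : Pt d → ℂ) =ᵐ[volume.restrict Ω] g →
          ∀ x ∈ Ω, g x = ∫ y in Ω, k x y * u y) ∧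
      (∀ k₁ k₂ : Pt d → Pt d → ℂ,
        (ContinuousOn (Function.uncurry k₁) (closure Ω ×ˢ closure Ω) ∧
          ∀ u : Lp ℂ 2 (volume.restrict Ω), ∀ g : Pt d → ℂ,
            ContinuousOn g (closure Ω) → (T t u : Pt d → ℂ) =ᵐ[volume.restrict Ω] g →
            ∀ x ∈ Ω, g x = ∫ y in Ω, k₁ x y * u y) →
        (ContinuousOn (Function.uncurry k₂) (closure Ω ×ˢ closure Ω) ∧
          ∀ u : Lp ℂ 2 (volume.restrict Ω), ∀ g : Pt d → ℂ,
            ContinuousOn g (closure Ω) → (T t u : Pt d → ℂ) =ᵐ[volume.restrict Ω] g →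
            ∀ x ∈ Ω, g x = ∫ y in Ω, k₂ x y * u y) →
        Set.EqOn (Function.uncurry k₁) (Function.uncurry k₂)
          (closure Ω ×ˢ closure Ω)) := by
  intro t ht
  constructor
  · have hs : 0 < t / 3 := by positivity
    obtain ⟨p, C, hpC, hp, hpA⟩ := skc_riesz hΩo hΩb (T (t/3)) (hcont _ hs)
    obtain ⟨q, D, hqD, hq, hqA⟩ := skc_riesz hΩo hΩb _ (hcont_adj _ hs)
    have hw := skc_normcont hΩo hΩb (T (t/3)) p q C D hpC hqD hp hq hpA
    refine ⟨fun x y => inner ℂ (p x) (T (t/3) (q y)), ?_, ?_⟩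
    · rintro ⟨x₀, y₀⟩ ⟨hx₀, hy₀⟩
      simp only at hx₀ hy₀
      change Tendsto _ _ _
      rw [nhdsWithin_prod_eq, tendsto_iff_norm_sub_tendsto_zero]
      have h1 : Tendsto (fun z : Pt d × Pt d => ‖T (t/3) (q z.2) - T (t/3) (q y₀)‖)
          (𝓝[closure Ω] x₀ ×ˢ 𝓝[closure Ω] y₀) (𝓝 0) :=
        (tendsto_iff_norm_sub_tendsto_zero.mp (hw y₀ hy₀)).comp tendsto_snd
      have h2 : Tendsto (fun z : Pt d × Pt d =>
          ‖(inner ℂ (p z.1) (T (t/3) (q y₀)) : ℂ) - inner ℂ (p x₀) (T (t/3) (q y₀))‖)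
          (𝓝[closure Ω] x₀ ×ˢ 𝓝[closure Ω] y₀) (𝓝 0) :=
        (tendsto_iff_norm_sub_tendsto_zero.mp (hp (T (t/3) (q y₀)) x₀ hx₀)).comp tendsto_fst
      have h3 := (h1.const_mul C).add h2
      rw [mul_zero, add_zero] at h3
      refine squeeze_zero' (Eventually.of_forall fun _ => norm_nonneg _) ?_ h3
      have hmem : ∀ᶠ z : Pt d × Pt d in 𝓝[closure Ω] x₀ ×ˢ 𝓝[closure Ω] y₀, z.1 ∈ closure Ω :=
        tendsto_fst.eventually (self_mem_nhdsWithin)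
      filter_upwards [hmem] with z hz
      simp only [Function.uncurry]
      calc ‖(inner ℂ (p z.1) (T (t/3) (q z.2)) : ℂ) - inner ℂ (p x₀) (T (t/3) (q y₀))‖
          = ‖(inner ℂ (p z.1) (T (t/3) (q z.2) - T (t/3) (q y₀)) : ℂ)
            + (inner ℂ (p z.1) (T (t/3) (q y₀)) - inner ℂ (p x₀) (T (t/3) (q y₀)))‖ := by
              rw [inner_sub_right]; ring_nf
        _ ≤ _ := norm_add_le _ _
        _ ≤ _ := by
          gcongr
          refine (norm_inner_le_norm _ _).trans ?_
          gcongr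
          exact hpC _ hz
    · intro u g hg hgu x hx
      have hT : T t u = T (t/3) (T (t/3) (T (t/3) u)) := by
        have h1 := hsemi (t/3) (t/3 + t/3) hs (by positivity)
        have h2 := hsemi (t/3) (t/3) hs hs
        rw [h2, show t/3 + (t/3 + t/3) = t by ring] at h1
        rw [h1]; rfl
      rw [hT] at hgu
      have h1 := skc_unique hΩo hg (hp _) (hgu.symm.trans (hpA _)) (subset_closure hx)
      rw [h1]
      simp only
      rw [← ContinuousLinearMap.adjoint_inner_left, ← ContinuousLinearMap.adjoint_inner_left,
        L2.inner_def]
      apply integral_congr_ae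
      filter_upwards [hqA (ContinuousLinearMap.adjoint (T (t/3)) (p x))] with y hy
      rw [hy, ContinuousLinearMap.adjoint_inner_right, RCLike.inner_apply, inner_conj_symm,
        mul_comm]
  · rintro k₁ k₂ ⟨hc₁, hk₁⟩ ⟨hc₂, hk₂⟩
    have hsec : ∀ k : Pt d → Pt d → ℂ,
        ContinuousOn (Function.uncurry k) (closure Ω ×ˢ closure Ω) → ∀ x ∈ Ω,
        ContinuousOn (k x) (closure Ω) := by
      intro k hk x hx
      exact hk.comp (f := fun y => (x, y)) (by fun_prop)
        (fun y hy => ⟨subset_closure hx, hy⟩)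
    have hstar : ∀ k : Pt d → Pt d → ℂ,
        ContinuousOn (Function.uncurry k) (closure Ω ×ˢ closure Ω) → ∀ x ∈ Ω,
        ContinuousOn (fun y => star (k x y)) (closure Ω) :=
      fun k hk x hx => (hsec k hk x hx).star
    have hin : ∀ k : Pt d → Pt d → ℂ,
        ∀ (hk : ContinuousOn (Function.uncurry k) (closure Ω ×ˢ closure Ω)), ∀ x, ∀ hx : x ∈ Ω,
        ∀ u : Lp ℂ 2 (volume.restrict Ω),
        inner ℂ ((skc_memLp hΩo hΩb (hstar k hk x hx)).toLp) u = ∫ y in Ω, k x y * u y := by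
      intro k hk x hx u
      rw [L2.inner_def]
      apply integral_congr_ae
      filter_upwards [(skc_memLp hΩo hΩb (hstar k hk x hx)).coeFn_toLp] with y hy
      rw [hy, RCLike.inner_apply, mul_comm]
      simp
    have hE : Set.EqOn (Function.uncurry k₁) (Function.uncurry k₂) (Ω ×ˢ Ω) := by
      rintro ⟨x, y⟩ ⟨hx, hy⟩
      simp only at hx hy
      have h1 : (skc_memLp hΩo hΩb (hstar k₁ hc₁ x hx)).toLp
          = (skc_memLp hΩo hΩb (hstar k₂ hc₂ x hx)).toLp := by
        refine ext_inner_right ℂ fun u => ?_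
        obtain ⟨g, hg, hgu⟩ := hcont t ht u
        rw [hin _ hc₁ _ hx, hin _ hc₂ _ hx, ← hk₁ u g hg hgu x hx, ← hk₂ u g hg hgu x hx]
      rw [MemLp.toLp_eq_toLp_iff] at h1
      have h2 := skc_unique hΩo (hstar k₁ hc₁ x hx) (hstar k₂ hc₂ x hx) h1 (subset_closure hy)
      exact star_injective h2
    exact hE.of_subset_closure hc₁ hc₂ (Set.prod_mono subset_closure subset_closure)
      (by rw [closure_prod_eq])
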